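/- The six rational functions g₁, g₂, g₃, g₄, g₅, g₆ ∈ ℂ(X₁₂,X₂₃,X₁₃,P₁₂,P₂₃,P₁₃) are algebraically independent over ℂ. -/

import Mathlib

set_option synthInstance.maxHeartbeats 1000000
set_option maxHeartbeats 2000000

noncomputable section

/-- The field `F = ℂ(X₁₂,X₂₃,X₁₃,P₁₂,P₂₃,P₁₃)` of rational functions in six variables. -/
abbrev FF : Type := FractionRing (MvPolynomial (Fin 6) ℂ)

instance : Field FF := inferInstance
instance : Algebra ℂ FF := inferInstance

def X12 : FF := algebraMap (MvPolynomial (Fin 6) ℂ) FF (MvPolynomial.X 0)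
def X23 : FF := algebraMap (MvPolynomial (Fin 6) ℂ) FF (MvPolynomial.X 1)
def X13 : FF := algebraMap (MvPolynomial (Fin 6) ℂ) FF (MvPolynomial.X 2)
def P12 : FF := algebraMap (MvPolynomial (Fin 6) ℂ) FF (MvPolynomial.X 3)
def P23 : FF := algebraMap (MvPolynomial (Fin 6) ℂ) FF (MvPolynomial.X 4)
def P13 : FF := algebraMap (MvPolynomial (Fin 6) ℂ) FF (MvPolynomial.X 5)

/-- The `(a,b)`-term of `g₁` (without the sign `a·b`). -/
def e1 (a b : ℤ) : FF :=
  ((1 - X23 * X12 ^ a * X13 ^ b) * (1 - X23⁻¹ * X12 ^ a * X13 ^ b)) /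
      (X12 ^ a * X13 ^ b * (X12 - X12⁻¹) * (X13 - X13⁻¹)) * (P12 ^ a * P13 ^ b)

/-- The `(a,b)`-term of `g₃` (without the sign `a·b`). -/
def e3 (a b : ℤ) : FF :=
  ((1 - X13 * X12 ^ a * X23 ^ b) * (1 - X13⁻¹ * X12 ^ a * X23 ^ b)) /
      (X12 ^ a * X23 ^ b * (X12 - X12⁻¹) * (X23 - X23⁻¹)) * (P12 ^ a * P23 ^ b)

/-- The `(a,b)`-term of `g₅` (without the sign `a·b`). -/
def e5 (a b : ℤ) : FF :=
  ((1 - X12 * X13 ^ a * X23 ^ b) * (1 - X12⁻¹ * X13 ^ a * X23 ^ b)) /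
      (X13 ^ a * X23 ^ b * (X13 - X13⁻¹) * (X23 - X23⁻¹)) * (P13 ^ a * P23 ^ b)

def g1 : FF := e1 1 1 - e1 1 (-1) - e1 (-1) 1 + e1 (-1) (-1)
def g2 : FF := X12 + X12⁻¹
def g3 : FF := e3 1 1 - e3 1 (-1) - e3 (-1) 1 + e3 (-1) (-1)
def g4 : FF := X23 + X23⁻¹
def g5 : FF := e5 1 1 - e5 1 (-1) - e5 (-1) 1 + e5 (-1) (-1)
def g6 : FF := X13 + X13⁻¹

namespace MvPolynomial

lemma totalDegree_pderiv_lt {σ k : Type*} [CommSemiring k] (p : MvPolynomial σ k) (i : σ)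
    (hp : 0 < p.totalDegree) : (pderiv i p).totalDegree < p.totalDegree := by
  rw [totalDegree, Finset.sup_lt_iff (by simpa using hp)]
  intro m hm
  have hm' : m + Finsupp.single i 1 ∈ p.support := by
    rw [mem_support_iff, coeff_pderiv] at hm
    exact mem_support_iff.2 (left_ne_zero_of_mul hm)
  have := le_totalDegree hm'
  rw [Finsupp.sum_add_index' (by simp) (by simp)] at this
  simp only [Finsupp.sum_single_index] at this
  omega

lemma totalDegree_eq_zero_of_pderiv_eq_zero {σ k : Type*} [Field k] [CharZero k]
    {p : MvPolynomial σ k} (hp : ∀ i, pderiv i p = 0) : p.totalDegree = 0 := by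
  rw [totalDegree_eq_zero_iff]
  intro m hm i
  by_contra hmi
  have h := congrArg (coeff (m - Finsupp.single i 1)) (hp i)
  have hle : Finsupp.single i 1 ≤ m := by
    simpa [Finsupp.single_le_iff] using Nat.one_le_iff_ne_zero.2 hmi
  rw [coeff_pderiv, tsub_add_cancel_of_le hle, coeff_zero] at h
  exact (mul_ne_zero (mem_support_iff.1 hm) (Nat.cast_add_one_ne_zero _)) h

/-- In characteristic zero, a family is algebraically independent as soon as its relations are
stable under partial derivatives. -/
lemma algebraicIndependent_of_aeval_pderiv {σ k A : Type*} [Field k] [CharZero k] [CommRing A]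
    [Nontrivial A] [Algebra k A] {x : σ → A}
    (h : ∀ p : MvPolynomial σ k, aeval x p = 0 → ∀ i, aeval x (pderiv i p) = 0) :
    AlgebraicIndependent k x := by
  rw [algebraicIndependent_iff]
  intro p
  induction hn : p.totalDegree using Nat.strong_induction_on generalizing p with
  | _ n ih =>
    intro hp
    have hdeg : p.totalDegree = 0 := by
      by_contra h0
      refine h0 (totalDegree_eq_zero_of_pderiv_eq_zero fun i => ?_)
      exact ih _ (hn ▸ totalDegree_pderiv_lt p i (Nat.pos_of_ne_zero h0)) _ rfl (h p hp i)
    rw [totalDegree_eq_zero_iff_eq_C] at hdeg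
    rw [hdeg, aeval_C, map_eq_zero_iff _ (algebraMap k A).injective] at hp
    rw [hdeg, hp, C_0]

lemma derivation_aeval {σ k A : Type*} [Fintype σ] [CommRing k] [CommRing A] [Algebra k A]
    (D : Derivation k A A) (x : σ → A) (p : MvPolynomial σ k) :
    D (aeval x p) = ∑ i, aeval x (pderiv i p) * D (x i) := by
  classical
  induction p using MvPolynomial.induction_on with
  | C a => simp
  | add p q hp hq => simp [hp, hq, add_mul, Finset.sum_add_distrib]
  | mul_X p j hp =>
    simp only [map_mul, aeval_X, Derivation.leibniz, hp, smul_eq_mul, map_add, add_mul,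
      Finset.sum_add_distrib, pderiv_X]
    congr 1
    · simp [Pi.single_apply, apply_ite]
    · rw [Finset.mul_sum]
      exact Finset.sum_congr rfl fun i _ => by ring

end MvPolynomial

/-- Derivations extend to localizations. -/
lemma Derivation.exists_extend_localization {k A K : Type*} [CommRing k] [CommRing A] [CommRing K]
    [Algebra k A] [Algebra A K] [Algebra k K] [IsScalarTower k A K] (M : Submonoid A)
    [IsLocalization M K] (d : Derivation k A K) :
    ∃ D : Derivation k K K, ∀ a, D (algebraMap A K a) = d a := by
  have hunit (m : M) : IsUnit (algebraMap A (Module.End A K) m) := by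
    rw [Module.End.isUnit_iff]
    have hm := IsLocalization.map_units K m
    convert IsUnit.isUnit_iff_mulLeft_bijective.1 hm using 2
    exact Algebra.smul_def _ _
  let f := IsLocalizedModule.lift M (KaehlerDifferential.map k k A K) d.liftKaehlerDifferential hunit
  refine ⟨(f.extendScalarsOfIsLocalization M K).compDer (KaehlerDifferential.D k K), fun a => ?_⟩
  have := IsLocalizedModule.lift_apply M (KaehlerDifferential.map k k A K)
    d.liftKaehlerDifferential hunit (KaehlerDifferential.D k A a)
  simpa using this

lemma Derivation.zpow_eq_mul_of_eigenvector {k K : Type*} [CommRing k] [Field K] [Algebra k K]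
    (D : Derivation k K K) {x c : K} (h : D x = c * x) (n : ℤ) : D (x ^ n) = n * c * x ^ n := by
  by_cases hx : x = 0
  · rcases eq_or_ne n 0 with rfl | hn
    · simp
    · simp [hx, zero_zpow n hn]
  have hnat (m : ℕ) : D (x ^ m) = m * c * x ^ m := by
    induction m with
    | zero => simp
    | succ m ih =>
      rw [pow_succ, D.leibniz, ih, h]
      simp only [smul_eq_mul]
      push_cast
      ring
  obtain ⟨m, rfl | rfl⟩ := n.eq_nat_or_neg
  · simpa using hnat m
  · rw [zpow_neg, zpow_natCast, D.leibniz_inv, hnat]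
    simp only [smul_eq_mul]
    push_cast
    field_simp

/-- The rational function `f` is regular at `v`, with value `c` there. -/
def HasValueAt {σ k : Type*} [Field k] (v : σ → k) (f : FractionRing (MvPolynomial σ k)) (c : k) :
    Prop :=
  ∃ n d : MvPolynomial σ k, MvPolynomial.eval v d ≠ 0 ∧
    f * algebraMap _ _ d = algebraMap _ _ n ∧ MvPolynomial.eval v n = c * MvPolynomial.eval v d

namespace HasValueAt

variable {σ k : Type*} [Field k] {v : σ → k} {f g : FractionRing (MvPolynomial σ k)} {c e : k}

lemma of_algebraMap (p : MvPolynomial σ k) :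
    HasValueAt v (algebraMap _ _ p) (MvPolynomial.eval v p) :=
  ⟨p, 1, by simp⟩

lemma one : HasValueAt v 1 (1 : k) := by
  simpa using of_algebraMap (v := v) (1 : MvPolynomial σ k)

lemma add (hf : HasValueAt v f c) (hg : HasValueAt v g e) : HasValueAt v (f + g) (c + e) := by
  obtain ⟨n, d, hd, hn, hc⟩ := hf
  obtain ⟨n', d', hd', hn', hc'⟩ := hg
  refine ⟨n * d' + n' * d, d * d', by simp [hd, hd'], ?_, ?_⟩
  · simp only [map_mul, map_add, ← hn, ← hn']
    ring
  · simp only [map_mul, map_add, hc, hc']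
    ring

lemma neg (hf : HasValueAt v f c) : HasValueAt v (-f) (-c) := by
  obtain ⟨n, d, hd, hn, hc⟩ := hf
  exact ⟨-n, d, hd, by simp [hn], by simp [hc]⟩

lemma sub (hf : HasValueAt v f c) (hg : HasValueAt v g e) : HasValueAt v (f - g) (c - e) := by
  simpa only [sub_eq_add_neg] using hf.add hg.neg

lemma mul (hf : HasValueAt v f c) (hg : HasValueAt v g e) : HasValueAt v (f * g) (c * e) := by
  obtain ⟨n, d, hd, hn, hc⟩ := hf
  obtain ⟨n', d', hd', hn', hc'⟩ := hg
  refine ⟨n * n', d * d', by simp [hd, hd'], ?_, ?_⟩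
  · simp only [map_mul, ← hn, ← hn']
    ring
  · simp only [map_mul, hc, hc']
    ring

lemma ne_zero (hf : HasValueAt v f c) (h : c ≠ 0) : f ≠ 0 := by
  rintro rfl
  obtain ⟨n, d, hd, hn, hc⟩ := hf
  have hn0 : n = 0 := by
    rw [zero_mul, eq_comm] at hn
    exact (map_eq_zero_iff _ (IsFractionRing.injective _ (FractionRing (MvPolynomial σ k)))).1 hn
  rw [hn0, map_zero, eq_comm] at hc
  exact mul_ne_zero h hd hc

lemma inv (hf : HasValueAt v f c) (h : c ≠ 0) : HasValueAt v f⁻¹ c⁻¹ := by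
  have hf0 := hf.ne_zero h
  obtain ⟨n, d, hd, hn, hc⟩ := hf
  refine ⟨d, n, hc ▸ mul_ne_zero h hd, ?_, ?_⟩
  · rw [← hn]
    field_simp
  · rw [hc]
    field_simp

lemma div (hf : HasValueAt v f c) (hg : HasValueAt v g e) (h : e ≠ 0) :
    HasValueAt v (f / g) (c / e) := by
  simpa only [div_eq_mul_inv] using hf.mul (hg.inv h)

lemma zpow (hf : HasValueAt v f c) (h : c ≠ 0) (n : ℤ) : HasValueAt v (f ^ n) (c ^ n) := by
  have hnat (m : ℕ) : HasValueAt v (f ^ m) (c ^ m) := by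
    induction m with
    | zero => simpa using one
    | succ m ih => simpa only [pow_succ] using ih.mul hf
  obtain ⟨m, rfl | rfl⟩ := n.eq_nat_or_neg
  · simpa using hnat m
  · simpa using (hnat m).inv (pow_ne_zero m h)

end HasValueAt

/-- The common shape of the terms `e1`, `e3`, `e5`. -/
def opTerm {K : Type*} [Field K] (x y z p q : K) (a b : ℤ) : K :=
  ((1 - z * x ^ a * y ^ b) * (1 - z⁻¹ * x ^ a * y ^ b)) /
      (x ^ a * y ^ b * (x - x⁻¹) * (y - y⁻¹)) * (p ^ a * q ^ b)

lemma Derivation.opTerm_eq_mul {k K : Type*} [CommRing k] [Field K] [Algebra k K]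
    (D : Derivation k K K) {x y z p q c d : K} (hx : D x = 0) (hy : D y = 0) (hz : D z = 0)
    (hp : D p = c * p) (hq : D q = d * q) (a b : ℤ) :
    D (opTerm x y z p q a b) = (a * c + b * d) * opTerm x y z p q a b := by
  have hxa : D (x ^ a) = 0 := by
    simpa using D.zpow_eq_mul_of_eigenvector (c := 0) (by simpa using hx) a
  have hyb : D (y ^ b) = 0 := by
    simpa using D.zpow_eq_mul_of_eigenvector (c := 0) (by simpa using hy) b
  simp only [opTerm, D.leibniz, D.leibniz_div, D.leibniz_inv, map_sub, D.map_one_eq_zero, hx, hy,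
    hz, hxa, hyb, D.zpow_eq_mul_of_eigenvector hp, D.zpow_eq_mul_of_eigenvector hq, smul_eq_mul]
  ring

lemma HasValueAt.opTerm {σ k : Type*} [Field k] {v : σ → k}
    {x y z p q : FractionRing (MvPolynomial σ k)} {x' y' z' p' q' : k} (hx : HasValueAt v x x')
    (hy : HasValueAt v y y') (hz : HasValueAt v z z') (hp : HasValueAt v p p')
    (hq : HasValueAt v q q') (hx0 : x' ≠ 0) (hy0 : y' ≠ 0) (hz0 : z' ≠ 0) (hp0 : p' ≠ 0)
    (hq0 : q' ≠ 0) (hx1 : x' - x'⁻¹ ≠ 0) (hy1 : y' - y'⁻¹ ≠ 0) (a b : ℤ) :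
    HasValueAt v (_root_.opTerm x y z p q a b) (_root_.opTerm x' y' z' p' q' a b) := by
  have hxa := hx.zpow hx0 a
  have hyb := hy.zpow hy0 b
  refine .mul (.div (.mul (one.sub ((hz.mul hxa).mul hyb))
    (one.sub (((hz.inv hz0).mul hxa).mul hyb)))
    (((hxa.mul hyb).mul (hx.sub (hx.inv hx0))).mul (hy.sub (hy.inv hy0))) ?_)
    ((hp.zpow hp0 a).mul (hq.zpow hq0 b))
  simp only [ne_eq, mul_eq_zero, not_or]
  exact ⟨⟨⟨zpow_ne_zero a hx0, zpow_ne_zero b hy0⟩, hx1⟩, hy1⟩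

/-- The image of the alternating sum of the `opTerm`s under a derivation that kills `x`, `y`, `z`
and for which `p` and `q` are eigenvectors with eigenvalues `c` and `d`. -/
def opSum {K : Type*} [Field K] (x y z p q c d : K) : K :=
  (c + d) * opTerm x y z p q 1 1 - (c - d) * opTerm x y z p q 1 (-1)
    - (d - c) * opTerm x y z p q (-1) 1 - (c + d) * opTerm x y z p q (-1) (-1)

lemma opSum_zero_zero {K : Type*} [Field K] (x y z p q : K) : opSum x y z p q 0 0 = 0 := by
  simp [opSum]

lemma Derivation.alternating_opTerm {k K : Type*} [CommRing k] [Field K] [Algebra k K]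
    (D : Derivation k K K) {x y z p q c d : K} (hx : D x = 0) (hy : D y = 0) (hz : D z = 0)
    (hp : D p = c * p) (hq : D q = d * q) :
    D (opTerm x y z p q 1 1 - opTerm x y z p q 1 (-1) - opTerm x y z p q (-1) 1
      + opTerm x y z p q (-1) (-1)) = opSum x y z p q c d := by
  simp only [map_add, map_sub, D.opTerm_eq_mul hx hy hz hp hq, opSum]
  push_cast
  ring

lemma HasValueAt.opSum {x y z p q c d : FF} {c' d' : ℂ}
    (hx : HasValueAt (fun _ => 2) x 2) (hy : HasValueAt (fun _ => 2) y 2)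
    (hz : HasValueAt (fun _ => 2) z 2) (hp : HasValueAt (fun _ => 2) p 2)
    (hq : HasValueAt (fun _ => 2) q 2) (hc : HasValueAt (fun _ => 2) c c')
    (hd : HasValueAt (fun _ => 2) d d') :
    HasValueAt (fun _ => 2) (_root_.opSum x y z p q c d) (35 / 12 * (c' + d')) := by
  have hT := HasValueAt.opTerm hx hy hz hp hq (by norm_num) (by norm_num) (by norm_num)
    (by norm_num) (by norm_num) (by norm_num) (by norm_num)
  have h := ((((hc.add hd).mul (hT 1 1)).sub ((hc.sub hd).mul (hT 1 (-1)))).sub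
    ((hd.sub hc).mul (hT (-1) 1))).sub ((hc.add hd).mul (hT (-1) (-1)))
  have hv : 35 / 12 * (c' + d') = _root_.opSum 2 2 2 2 2 c' d' := by
    norm_num [_root_.opSum, _root_.opTerm]
    ring
  rw [hv]
  exact h

lemma exists_eulerDerivation (i : Fin 6) : ∃ D : Derivation ℂ FF FF, ∀ j,
    D (algebraMap (MvPolynomial (Fin 6) ℂ) FF (MvPolynomial.X j)) =
      (if j = i then 1 else 0) * algebraMap (MvPolynomial (Fin 6) ℂ) FF (MvPolynomial.X j) := by
  obtain ⟨D, hD⟩ := Derivation.exists_extend_localization (K := FF)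
    (nonZeroDivisors (MvPolynomial (Fin 6) ℂ)) (MvPolynomial.mkDerivation ℂ fun j =>
      (if j = i then 1 else 0) * algebraMap (MvPolynomial (Fin 6) ℂ) FF (MvPolynomial.X j))
  exact ⟨D, fun j => by rw [hD, MvPolynomial.mkDerivation_X]⟩

lemma hasValueAt_algebraMap_X (j : Fin 6) :
    HasValueAt (fun _ => 2) (algebraMap (MvPolynomial (Fin 6) ℂ) FF (MvPolynomial.X j)) 2 := by
  simpa using HasValueAt.of_algebraMap (v := fun _ => (2 : ℂ)) (MvPolynomial.X j)

lemma derivation_add_inv_ne_zero (D : Derivation ℂ FF FF) {x : FF}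
    (hx : HasValueAt (fun _ => 2) x 2) (hD : D x = x) : D (x + x⁻¹) ≠ 0 := by
  have hx0 : x ≠ 0 := hx.ne_zero (by norm_num)
  have : D (x + x⁻¹) = x - x⁻¹ := by
    rw [map_add, D.leibniz_inv, hD, smul_eq_mul]
    field_simp
    ring
  rw [this]
  exact (hx.sub (hx.inv (by norm_num))).ne_zero (by norm_num)

/-- the six rational functions `g₁,…,g₆` (the classical limits of the six
generating `q`-difference operators) are algebraically independent over `ℂ`. -/
theorem g_algebraically_independent :
    AlgebraicIndependent ℂ ![g1, g2, g3, g4, g5, g6] := by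
  apply MvPolynomial.algebraicIndependent_of_aeval_pderiv
  intro r hr
  have key (D : Derivation ℂ FF FF) := MvPolynomial.derivation_aeval D ![g1, g2, g3, g4, g5, g6] r
  simp only [hr, map_zero, Fin.sum_univ_six] at key
  generalize hu : (fun i => MvPolynomial.aeval ![g1, g2, g3, g4, g5, g6]
    (MvPolynomial.pderiv i r)) = u
  replace hu (i) := congrFun hu i
  simp only [hu] at key ⊢
  choose E hE using exists_eulerDerivation
  have hX12 (i) : E i X12 = (if 0 = i then 1 else 0) * X12 := hE i 0
  have hX23 (i) : E i X23 = (if 1 = i then 1 else 0) * X23 := hE i 1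
  have hX13 (i) : E i X13 = (if 2 = i then 1 else 0) * X13 := hE i 2
  have hP12 (i) : E i P12 = (if 3 = i then 1 else 0) * P12 := hE i 3
  have hP23 (i) : E i P23 = (if 4 = i then 1 else 0) * P23 := hE i 4
  have hP13 (i) : E i P13 = (if 5 = i then 1 else 0) * P13 := hE i 5
  have hX (i : Fin 6) (hi : 2 < i) : E i X12 = 0 ∧ E i X23 = 0 ∧ E i X13 = 0 := by
    rw [hX12, hX23, hX13, if_neg (by omega), if_neg (by omega), if_neg (by omega)]
    simp
  have hg1 (i) (hi : 2 < i) : E i g1 = opSum X12 X13 X23 P12 P13 (if 3 = i then 1 else 0)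
      (if 5 = i then 1 else 0) :=
    (E i).alternating_opTerm (hX i hi).1 (hX i hi).2.2 (hX i hi).2.1 (hP12 i) (hP13 i)
  have hg3 (i) (hi : 2 < i) : E i g3 = opSum X12 X23 X13 P12 P23 (if 3 = i then 1 else 0)
      (if 4 = i then 1 else 0) :=
    (E i).alternating_opTerm (hX i hi).1 (hX i hi).2.1 (hX i hi).2.2 (hP12 i) (hP23 i)
  have hg5 (i) (hi : 2 < i) : E i g5 = opSum X13 X23 X12 P13 P23 (if 5 = i then 1 else 0)
      (if 4 = i then 1 else 0) :=
    (E i).alternating_opTerm (hX i hi).2.2 (hX i hi).2.1 (hX i hi).1 (hP13 i) (hP23 i)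
  have h3 := key (E 3)
  have h4 := key (E 4)
  have h5 := key (E 5)
  simp [hg1, hg3, hg5, g2, g4, g6, hX12, hX23, hX13, Derivation.leibniz_inv, opSum_zero_zero]
    at h3 h4 h5
  have vX12 : HasValueAt (fun _ => 2) X12 2 := hasValueAt_algebraMap_X 0
  have vX23 : HasValueAt (fun _ => 2) X23 2 := hasValueAt_algebraMap_X 1
  have vX13 : HasValueAt (fun _ => 2) X13 2 := hasValueAt_algebraMap_X 2
  have vP12 : HasValueAt (fun _ => 2) P12 2 := hasValueAt_algebraMap_X 3
  have vP23 : HasValueAt (fun _ => 2) P23 2 := hasValueAt_algebraMap_X 4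
  have vP13 : HasValueAt (fun _ => 2) P13 2 := hasValueAt_algebraMap_X 5
  have v0 : HasValueAt (fun _ => 2) (0 : FF) (0 : ℂ) := by
    simpa using HasValueAt.of_algebraMap (v := fun _ => (2 : ℂ)) (0 : MvPolynomial (Fin 6) ℂ)
  have v1 : HasValueAt (fun _ => 2) (1 : FF) (1 : ℂ) := HasValueAt.one
  have vA1 := HasValueAt.opSum vX12 vX13 vX23 vP12 vP13 v1 v0
  have vB1 := HasValueAt.opSum vX12 vX13 vX23 vP12 vP13 v0 v1
  have vA3 := HasValueAt.opSum vX12 vX23 vX13 vP12 vP23 v1 v0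
  have vB3 := HasValueAt.opSum vX12 vX23 vX13 vP12 vP23 v0 v1
  have vA5 := HasValueAt.opSum vX13 vX23 vX12 vP13 vP23 v1 v0
  have vB5 := HasValueAt.opSum vX13 vX23 vX12 vP13 vP23 v0 v1
  have hdet := (((vA1.mul vA5).mul vB3).add ((vA3.mul vB1).mul vB5)).ne_zero (by norm_num)
  have hA3 := vA3.ne_zero (by norm_num)
  have hA5 := vA5.ne_zero (by norm_num)
  have hu0 : u 0 = 0 := by
    refine (mul_eq_zero.1 ?_).resolve_right hdet
    linear_combination (-opSum X13 X23 X12 P13 P23 1 0 * opSum X12 X23 X13 P12 P23 0 1) * h3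
      + (opSum X12 X23 X13 P12 P23 1 0 * opSum X13 X23 X12 P13 P23 1 0) * h4
      - (opSum X12 X23 X13 P12 P23 1 0 * opSum X13 X23 X12 P13 P23 0 1) * h5
  have hu2 : u 2 = 0 := by simpa [hu0, hA3] using h3
  have hu4 : u 4 = 0 := by simpa [hu0, hA5] using h5
  have hadd (i : Fin 6) (x : FF) (hx : E i x = 0) : E i (x + x⁻¹) = 0 := by
    simp [(E i).leibniz_inv, hx]
  have hu1 : u 1 = 0 := by
    have hne : E 0 g2 ≠ 0 := derivation_add_inv_ne_zero _ vX12 (by simp [hX12])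
    have h4 : E 0 g4 = 0 := hadd _ _ (by simp [hX23])
    have h6 : E 0 g6 = 0 := hadd _ _ (by simp [hX13])
    simpa [hu0, hu2, hu4, h4, h6, hne] using key (E 0)
  have hu3 : u 3 = 0 := by
    have hne : E 1 g4 ≠ 0 := derivation_add_inv_ne_zero _ vX23 (by simp [hX23])
    have h2 : E 1 g2 = 0 := hadd _ _ (by simp [hX12])
    have h6 : E 1 g6 = 0 := hadd _ _ (by simp [hX13])
    simpa [hu0, hu2, hu4, h2, h6, hne] using key (E 1)
  have hu5 : u 5 = 0 := by
    have hne : E 2 g6 ≠ 0 := derivation_add_inv_ne_zero _ vX13 (by simp [hX13])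
    have h2 : E 2 g2 = 0 := hadd _ _ (by simp [hX12])
    have h4 : E 2 g4 = 0 := hadd _ _ (by simp [hX23])
    simpa [hu0, hu2, hu4, h2, h4, hne] using key (E 2)
  intro i
  fin_cases i <;> assumption
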